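/- For each fixed integer m ≥ 2 and fixed J ≥ 1, as n → ∞, (−1)^m Φ_k^{(m)}(σ_n) = (a_k^{1+1/k}/σ_n^{m+1/k}) ∏_{1 ≤ ℓ < m} (ℓ + 1/k) − (m−1)!/(2σ_n^m) + O(σ_n^J), where a_k := (k^{-1} ζ(1+1/k) Γ(1+1/k))^{k/(k+1)}. -/

import Mathlib

open Real

/-- `Φ_k(σ) = ∑_{m ≥ 1} -log(1 - e^{-m^k σ})` for real `σ > 0`. -/
noncomputable def Phi (k : ℕ) (σ : ℝ) : ℝ :=
  ∑' m : ℕ, -Real.log (1 - Real.exp (-((m + 1 : ℕ) : ℝ) ^ k * σ))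

/-- `a_k = (k⁻¹ ζ(1 + 1/k) Γ(1 + 1/k))^{k/(k+1)}`. -/
noncomputable def ak (k : ℕ) : ℝ :=
  ((k : ℝ)⁻¹ * (riemannZeta (1 + 1 / (k : ℂ))).re * Real.Gamma (1 + 1 / (k : ℝ))) ^
    ((k : ℝ) / (k + 1))

section

open Set Filter Topology MeasureTheory SchwartzMap
open scoped ContDiff FourierTransform

/-- The Bose–Einstein function `u ↦ 1 / (e^u - 1)`. -/
noncomputable def bose (u : ℝ) : ℝ := (exp u - 1)⁻¹

lemma exp_sub_one_ne_zero {u : ℝ} (hu : u ≠ 0) : exp u - 1 ≠ 0 := by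
  rw [sub_ne_zero]; simpa using hu

lemma hasDerivAt_bose {u : ℝ} (hu : u ≠ 0) :
    HasDerivAt bose (-(bose u + bose u ^ 2)) u := by
  have h := exp_sub_one_ne_zero hu
  refine (((hasDerivAt_exp u).sub_const 1).inv h).congr_deriv ?_
  unfold bose
  field_simp
  ring

lemma bose_pos {u : ℝ} (hu : 0 < u) : 0 < bose u :=
  inv_pos.2 (by linarith [add_one_lt_exp hu.ne'])

lemma contDiff_dslope_exp : ContDiff ℝ ∞ (dslope exp 0) := by
  rw [contDiff_iff_contDiffAt]
  intro u
  rcases eq_or_ne u 0 with rfl | hu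
  · obtain ⟨p, hp⟩ := analyticAt_rexp (x := 0)
    exact (hp.has_fpower_series_dslope_fslope.analyticAt).contDiffAt
  · have h : ContDiffAt ℝ ∞ (fun x : ℝ => (exp x - exp 0) / (x - 0)) u :=
      (contDiff_exp.contDiffAt.sub contDiffAt_const).div
        (contDiffAt_id.sub contDiffAt_const) (by simpa using hu)
    refine h.congr_of_eventuallyEq ?_
    filter_upwards [isOpen_ne.mem_nhds hu] with x hx
    rw [dslope_of_ne _ hx, slope_def_field]

lemma dslope_exp_ne_zero (u : ℝ) : dslope exp 0 u ≠ 0 := by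
  rcases eq_or_ne u 0 with rfl | hu
  · simp
  · rw [dslope_of_ne _ hu, slope_def_field]
    simpa [hu] using exp_sub_one_ne_zero hu

/-- The smooth even extension of `u ↦ u ^ 2 * (bose u + bose u ^ 2)`, that is of
`(u / 2) ^ 2 / sinh (u / 2) ^ 2`. -/
noncomputable def boseKernel (u : ℝ) : ℝ := (dslope exp 0 u)⁻¹ * (dslope exp 0 (-u))⁻¹

lemma contDiff_boseKernel : ContDiff ℝ ∞ boseKernel :=
  (contDiff_dslope_exp.inv dslope_exp_ne_zero).mul
    ((contDiff_dslope_exp.comp contDiff_neg).inv fun u => dslope_exp_ne_zero (-u))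

lemma boseKernel_neg (u : ℝ) : boseKernel (-u) = boseKernel u := by
  simp [boseKernel, mul_comm]

lemma boseKernel_zero : boseKernel 0 = 1 := by simp [boseKernel]

lemma boseKernel_eq {u : ℝ} (hu : u ≠ 0) : boseKernel u = u ^ 2 * (bose u + bose u ^ 2) := by
  have h := exp_sub_one_ne_zero hu
  have h' : 1 - exp u ≠ 0 := by rw [← neg_sub]; exact neg_ne_zero.2 h
  rw [boseKernel, dslope_of_ne _ hu, dslope_of_ne _ (neg_ne_zero.2 hu), slope_def_field,
    slope_def_field, exp_neg, bose]
  have := exp_ne_zero u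
  simp only [exp_zero, sub_zero]
  have e : (exp u)⁻¹ - 1 = (1 - exp u) / exp u := by field_simp
  rw [e]
  field_simp
  ring

/-- The linear span of the functions `u ↦ u ^ i * bose u ^ (j + 1)`. -/
noncomputable def boseSpan : Submodule ℝ (ℝ → ℝ) :=
  Submodule.span ℝ (range fun p : ℕ × ℕ => fun u : ℝ => u ^ p.1 * bose u ^ (p.2 + 1))

lemma mem_boseSpan (i j : ℕ) : (fun u : ℝ => u ^ i * bose u ^ (j + 1)) ∈ boseSpan :=
  Submodule.subset_span ⟨(i, j), rfl⟩

lemma exists_hasDerivAt_of_mem_boseSpan {f : ℝ → ℝ} (hf : f ∈ boseSpan) :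
    ∃ g ∈ boseSpan, ∀ u, 0 < u → HasDerivAt f (g u) u := by
  induction hf using Submodule.span_induction with
  | mem f hf =>
    obtain ⟨⟨i, j⟩, rfl⟩ := hf
    refine ⟨_, boseSpan.sub_mem (boseSpan.smul_mem (i : ℝ) (mem_boseSpan (i - 1) j))
      (boseSpan.smul_mem ((j : ℝ) + 1)
        (boseSpan.add_mem (mem_boseSpan i j) (mem_boseSpan i (j + 1)))), fun u hu => ?_⟩
    refine ((hasDerivAt_pow i u).mul ((hasDerivAt_bose hu.ne').pow (j + 1))).congr_deriv ?_
    simp only [Pi.sub_apply, Pi.smul_apply, Pi.add_apply, smul_eq_mul]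
    push_cast
    simp
    ring
  | zero => exact ⟨0, boseSpan.zero_mem, fun u _ => hasDerivAt_const u 0⟩
  | add f g _ _ ihf ihg =>
    obtain ⟨f', hf', hf⟩ := ihf
    obtain ⟨g', hg', hg⟩ := ihg
    exact ⟨f' + g', boseSpan.add_mem hf' hg', fun u hu => (hf u hu).add (hg u hu)⟩
  | smul c f _ ihf =>
    obtain ⟨f', hf', hf⟩ := ihf
    exact ⟨c • f', boseSpan.smul_mem c hf', fun u hu => (hf u hu).const_smul c⟩

lemma exists_iteratedDeriv_eq_of_mem_boseSpan (n : ℕ) {f : ℝ → ℝ} (hf : f ∈ boseSpan) :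
    ∃ g ∈ boseSpan, ∀ u, 0 < u → iteratedDeriv n f u = g u := by
  induction n with
  | zero => exact ⟨f, hf, fun u _ => by simp⟩
  | succ n ih =>
    obtain ⟨g, hg, hfg⟩ := ih
    obtain ⟨g', hg', hgg'⟩ := exists_hasDerivAt_of_mem_boseSpan hg
    refine ⟨g', hg', fun u hu => ?_⟩
    rw [iteratedDeriv_succ, ← (hgg' u hu).deriv]
    refine EventuallyEq.deriv_eq ?_
    filter_upwards [Ioi_mem_nhds hu] with x hx using hfg x hx

lemma pow_mul_bose_le (M : ℕ) {u : ℝ} (hu : 1 ≤ u) : u ^ M * bose u ≤ 2 * M.factorial := by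
  have h1 : (2 : ℝ) ≤ exp u := by linarith [add_one_le_exp u]
  have h2 : u ^ M / M.factorial ≤ exp u := pow_div_factorial_le_exp u (by linarith) M
  have h3 : (0 : ℝ) < M.factorial := by positivity
  rw [div_le_iff₀ h3] at h2
  rw [bose, ← div_eq_mul_inv, div_le_iff₀ (by linarith)]
  nlinarith

lemma exists_pow_mul_le_of_mem_boseSpan (N : ℕ) {f : ℝ → ℝ} (hf : f ∈ boseSpan) :
    ∃ C, ∀ u, 1 ≤ u → u ^ N * |f u| ≤ C := by
  induction hf using Submodule.span_induction with
  | mem f hf =>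
    obtain ⟨⟨i, j⟩, rfl⟩ := hf
    refine ⟨2 * (N + i).factorial, fun u hu => ?_⟩
    have hb := bose_pos (by linarith : 0 < u)
    have hb1 : bose u ≤ 1 := inv_le_one_of_one_le₀ (by linarith [add_one_le_exp u])
    have hb2 : bose u ^ (j + 1) ≤ bose u := by
      simpa using pow_le_pow_of_le_one hb.le hb1 (show 1 ≤ j + 1 by lia)
    refine le_trans ?_ (pow_mul_bose_le (N + i) hu)
    have : 0 ≤ u := by linarith
    rw [abs_of_nonneg (by positivity), ← mul_assoc, ← pow_add]
    gcongr
  | zero => exact ⟨0, by simp⟩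
  | add f g _ _ ihf ihg =>
    obtain ⟨C, hC⟩ := ihf
    obtain ⟨D, hD⟩ := ihg
    refine ⟨C + D, fun u hu => ?_⟩
    have : 0 ≤ u := by linarith
    calc u ^ N * |f u + g u| ≤ u ^ N * (|f u| + |g u|) := by gcongr; exact abs_add_le _ _
      _ ≤ C + D := by rw [mul_add]; exact add_le_add (hC u hu) (hD u hu)
  | smul c f _ ihf =>
    obtain ⟨C, hC⟩ := ihf
    refine ⟨|c| * C, fun u hu => ?_⟩
    rw [Pi.smul_apply, smul_eq_mul, abs_mul, mul_left_comm]
    exact mul_le_mul_of_nonneg_left (hC u hu) (abs_nonneg c)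

lemma exists_pow_mul_iteratedDeriv_boseKernel_le (N n : ℕ) :
    ∃ C, ∀ u, 1 ≤ u → u ^ N * |iteratedDeriv n boseKernel u| ≤ C := by
  obtain ⟨g, hg, hfg⟩ := exists_iteratedDeriv_eq_of_mem_boseSpan n
    (boseSpan.add_mem (mem_boseSpan 2 0) (mem_boseSpan 2 1))
  obtain ⟨C, hC⟩ := exists_pow_mul_le_of_mem_boseSpan N hg
  refine ⟨C, fun u hu => ?_⟩
  have hu0 : 0 < u := by linarith
  convert hC u hu using 3
  rw [← hfg u hu0]
  refine EventuallyEq.iteratedDeriv_eq n ?_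
  filter_upwards [Ioi_mem_nhds hu0] with x hx
  rw [boseKernel_eq hx.ne']
  simp
  ring

lemma boseKernel_decay (N n : ℕ) :
    ∃ C, ∀ u, ‖u‖ ^ N * ‖iteratedFDeriv ℝ n boseKernel u‖ ≤ C := by
  simp only [norm_iteratedFDeriv_eq_norm_iteratedDeriv, Real.norm_eq_abs]
  have hev (u : ℝ) : |iteratedDeriv n boseKernel (-u)| = |iteratedDeriv n boseKernel u| := by
    have h := iteratedDeriv_comp_neg n boseKernel u
    simp only [boseKernel_neg] at h
    rw [h]
    simp [abs_mul]
  obtain ⟨C, hC⟩ := exists_pow_mul_iteratedDeriv_boseKernel_le N n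
  have hcont : Continuous fun u => |u| ^ N * |iteratedDeriv n boseKernel u| :=
    (continuous_abs.pow N).mul
      (contDiff_boseKernel.continuous_iteratedDeriv n (mod_cast le_top)).abs
  obtain ⟨D, hD⟩ := (isCompact_Icc (a := (-1 : ℝ)) (b := 1)).bddAbove_image hcont.continuousOn
  refine ⟨max C D, fun u => ?_⟩
  rcases le_or_gt 1 |u| with h | h
  · refine le_max_of_le_left ?_
    rcases abs_cases u with ⟨hu, -⟩ | ⟨hu, -⟩
    · rw [hu] at h ⊢
      exact hC u h
    · rw [← hev u, hu]
      exact hC _ (hu ▸ h)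
  · exact le_max_of_le_right (hD ⟨u, ⟨(abs_lt.1 h).1.le, (abs_lt.1 h).2.le⟩, rfl⟩)

/-- `boseKernel` as a Schwartz function. -/
noncomputable def boseSchwartz : 𝓢(ℝ, ℝ) where
  toFun := boseKernel
  smooth' := contDiff_boseKernel
  decay' := boseKernel_decay

/-- The Schwartz function `u ↦ -u ^ (j + 2) * bose^{(j + 1)} u`. -/
noncomputable def boseDeriv : ℕ → 𝓢(ℝ, ℝ)
  | 0 => boseSchwartz
  | j + 1 => smulLeftCLM ℝ (fun x : ℝ => x) (derivCLM ℝ ℝ (boseDeriv j)) -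
      ((j : ℝ) + 2) • boseDeriv j

lemma boseDeriv_zero_apply (u : ℝ) : boseDeriv 0 u = boseKernel u := rfl

lemma boseDeriv_succ_apply (j : ℕ) (u : ℝ) :
    boseDeriv (j + 1) u = u * deriv (boseDeriv j) u - ((j : ℝ) + 2) * boseDeriv j u := by
  rw [boseDeriv, sub_apply, smul_apply, smulLeftCLM_apply_apply (by fun_prop)]
  rfl

lemma boseDeriv_neg (j : ℕ) (u : ℝ) : boseDeriv j (-u) = boseDeriv j u := by
  induction j generalizing u with
  | zero => exact boseKernel_neg u
  | succ j ih =>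
    have h := deriv_comp_neg (boseDeriv j) u
    simp only [ih] at h
    rw [boseDeriv_succ_apply, boseDeriv_succ_apply, ih, h]
    ring

lemma boseDeriv_apply_zero (j : ℕ) : boseDeriv j 0 = (-1) ^ j * (j + 1).factorial := by
  induction j with
  | zero => simp [boseDeriv_zero_apply, boseKernel_zero]
  | succ j ih =>
    rw [boseDeriv_succ_apply, ih, Nat.factorial_succ (j + 1)]
    push_cast
    ring

/-- The `j`-th derivative of `u ↦ -log (1 - e^{-u})` on the positive half-line. -/
noncomputable def logDer : ℕ → ℝ → ℝ
  | 0 => fun u => -log (1 - exp (-u))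
  | 1 => fun u => -bose u
  | j + 2 => fun u => boseDeriv j u / u ^ (j + 2)

lemma logDer_zero (u : ℝ) : logDer 0 u = -log (1 - exp (-u)) := rfl

lemma logDer_one (u : ℝ) : logDer 1 u = -bose u := rfl

lemma logDer_add_two (j : ℕ) (u : ℝ) : logDer (j + 2) u = boseDeriv j u / u ^ (j + 2) := rfl

lemma hasDerivAt_logDer (j : ℕ) {u : ℝ} (hu : 0 < u) :
    HasDerivAt (logDer j) (logDer (j + 1) u) u := by
  have hu0 := hu.ne'
  match j with
  | 0 =>
    have h : 1 - exp (-u) ≠ 0 := by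
      have : exp (-u) < 1 := by simpa using hu
      linarith
    have h' := exp_sub_one_ne_zero hu0
    refine ((((hasDerivAt_neg u).exp.const_sub 1).log h).neg).congr_deriv ?_
    have e : 1 - exp (-u) = (exp u - 1) / exp u := by
      rw [exp_neg]; field_simp
    rw [e, exp_neg, logDer_one, bose]
    field_simp
  | 1 =>
    refine (hasDerivAt_bose hu0).neg.congr_deriv ?_
    rw [logDer_add_two, boseDeriv_zero_apply, boseKernel_eq hu0]
    field_simp
  | j + 2 =>
    refine (((boseDeriv j).hasDerivAt u).div (hasDerivAt_pow (j + 2) u)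
      (pow_ne_zero _ hu0)).congr_deriv ?_
    rw [logDer_add_two, boseDeriv_succ_apply]
    push_cast
    field_simp
    ring

lemma exists_abs_logDer_le (j : ℕ) : ∃ C, ∀ u, 0 < u → |logDer j u| ≤ C / u ^ (j + 2) := by
  have hexp (u : ℝ) (hu : 0 < u) : u + u ^ 2 / 2 + u ^ 3 / 6 ≤ exp u - 1 := by
    have := sum_le_exp_of_nonneg hu.le 4
    simp [Finset.sum_range_succ, Nat.factorial] at this
    linarith
  match j with
  | 0 =>
    refine ⟨2, fun u hu => ?_⟩
    have h1 : exp (-u) < 1 := by simpa using hu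
    have hE : 0 < exp u - 1 := by linarith [add_one_lt_exp hu.ne']
    have e : -log (1 - exp (-u)) = log (1 + bose u) := by
      rw [← log_inv]
      congr 1
      have : 1 - exp (-u) ≠ 0 := by linarith
      rw [exp_neg, bose] at *
      field_simp
      ring
    have hb := bose_pos hu
    rw [logDer_zero, e, abs_of_nonneg (log_nonneg (by linarith))]
    refine (log_le_sub_one_of_pos (by linarith)).trans ?_
    rw [add_sub_cancel_left, bose, inv_eq_one_div, div_le_div_iff₀ hE (by positivity)]
    have := hexp u hu
    have : 0 < u ^ 3 := by positivity
    ring_nf at *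
    linarith
  | 1 =>
    refine ⟨6, fun u hu => ?_⟩
    have hE : 0 < exp u - 1 := by linarith [add_one_lt_exp hu.ne']
    rw [logDer_one, abs_neg, abs_of_pos (bose_pos hu), bose, inv_eq_one_div,
      div_le_div_iff₀ hE (by positivity)]
    have := hexp u hu
    have : 0 < u ^ 2 := by positivity
    ring_nf at *
    linarith
  | j + 2 =>
    obtain ⟨C, -, hC⟩ := (boseDeriv j).decay 2 0
    refine ⟨C, fun u hu => ?_⟩
    have h := hC u
    rw [norm_iteratedFDeriv_zero, Real.norm_eq_abs, Real.norm_eq_abs, abs_of_pos hu] at h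
    rw [logDer_add_two, abs_div, abs_of_pos (pow_pos hu _),
      div_le_div_iff₀ (by positivity) (by positivity), pow_add u (j + 2) 2]
    calc |boseDeriv j u| * (u ^ (j + 2) * u ^ 2) = (u ^ 2 * |boseDeriv j u|) * u ^ (j + 2) := by
          ring
      _ ≤ C * u ^ (j + 2) := by gcongr

lemma exists_abs_pow_mul_logDer_le {k : ℕ} (hk : 1 ≤ k) (j : ℕ) {δ : ℝ} (hδ : 0 < δ) :
    ∃ C, ∀ (n : ℕ) (s : ℝ), δ < s →
      ‖(((n + 1 : ℕ) : ℝ) ^ k) ^ j * logDer j (((n + 1 : ℕ) : ℝ) ^ k * s)‖ ≤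
        C * (1 / ((n + 1 : ℕ) : ℝ) ^ 2) := by
  obtain ⟨C, hC⟩ := exists_abs_logDer_le j
  have hC0 : 0 ≤ C := by simpa using (abs_nonneg _).trans (hC 1 one_pos)
  refine ⟨C / δ ^ (j + 2), fun n s hs => ?_⟩
  have hs0 : 0 < s := hδ.trans hs
  set c : ℝ := ((n + 1 : ℕ) : ℝ) ^ k with hc
  have hn : (1 : ℝ) ≤ ((n + 1 : ℕ) : ℝ) := by simp
  have hnc : ((n + 1 : ℕ) : ℝ) ≤ c := by
    simpa [hc] using pow_le_pow_right₀ hn hk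
  have hc0 : 0 < c := by linarith
  rw [norm_mul, Real.norm_eq_abs, Real.norm_eq_abs, abs_of_pos (pow_pos hc0 j)]
  calc c ^ j * |logDer j (c * s)| ≤ c ^ j * (C / (c * s) ^ (j + 2)) := by
        gcongr
        exact hC _ (by positivity)
    _ = C / s ^ (j + 2) * (1 / c ^ 2) := by
        rw [mul_pow, pow_add c]
        field_simp
    _ ≤ C / δ ^ (j + 2) * (1 / ((n + 1 : ℕ) : ℝ) ^ 2) := by gcongr

lemma summable_one_div_succ_sq : Summable fun n : ℕ => 1 / ((n + 1 : ℕ) : ℝ) ^ 2 :=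
  (summable_nat_add_iff 1).2 (summable_one_div_nat_pow.2 one_lt_two)

lemma iteratedDeriv_Phi {k : ℕ} (hk : 1 ≤ k) (j : ℕ) {s : ℝ} (hs : 0 < s) :
    iteratedDeriv j (Phi k) s =
      ∑' n : ℕ, (((n + 1 : ℕ) : ℝ) ^ k) ^ j * logDer j (((n + 1 : ℕ) : ℝ) ^ k * s) := by
  induction j generalizing s with
  | zero => simp [Phi, logDer]
  | succ j ih =>
    have hev : iteratedDeriv j (Phi k) =ᶠ[𝓝 s] fun s =>
        ∑' n : ℕ, (((n + 1 : ℕ) : ℝ) ^ k) ^ j * logDer j (((n + 1 : ℕ) : ℝ) ^ k * s) := by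
      filter_upwards [Ioi_mem_nhds hs] with x hx using ih hx
    rw [iteratedDeriv_succ, hev.deriv_eq]
    obtain ⟨C, hC⟩ := exists_abs_pow_mul_logDer_le hk j (half_pos hs)
    obtain ⟨D, hD⟩ := exists_abs_pow_mul_logDer_le hk (j + 1) (half_pos hs)
    refine (hasDerivAt_tsum_of_isPreconnected (summable_one_div_succ_sq.mul_left D)
      (isOpen_Ioi (a := s / 2)) isPreconnected_Ioi (fun n y hy => ?_) (fun n y hy => hD n y hy)
      (half_lt_self hs) ?_ (half_lt_self hs)).deriv
    · have hy0 : 0 < ((n + 1 : ℕ) : ℝ) ^ k * y :=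
        mul_pos (by positivity) ((half_pos hs).trans hy)
      refine (((hasDerivAt_logDer j hy0).comp y
        ((hasDerivAt_id y).const_mul _)).const_mul _).congr_deriv ?_
      ring
    · exact .of_norm_bounded (summable_one_div_succ_sq.mul_left C)
        fun n => hC n s (half_lt_self hs)

lemma summable_schwartz_int (g : 𝓢(ℝ, ℂ)) : Summable fun n : ℤ => g n :=
  summable_of_isBigO (Real.summable_abs_int_rpow one_lt_two)
    ((g.isBigO_cocompact_rpow (-2)).comp_tendsto Int.tendsto_coe_cofinite)

lemma fourier_comp_mul_right (g : ℝ → ℂ) {t : ℝ} (ht : 0 < t) (w : ℝ) :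
    𝓕 (fun x => g (x * t)) w = (t⁻¹ : ℝ) * 𝓕 g (w / t) := by
  rw [Real.fourier_real_eq_integral_exp_smul, Real.fourier_real_eq_integral_exp_smul]
  have h := Measure.integral_comp_mul_right
    (fun y : ℝ => Complex.exp (↑(-2 * π * y * (w / t)) * Complex.I) • g y) t
  rw [abs_of_pos (inv_pos.2 ht)] at h
  rw [← Complex.real_smul, ← h]
  refine integral_congr_ae (.of_forall fun x => ?_)
  have : -2 * π * (x * t) * (w / t) = -2 * π * x * w := by field_simp
  simp only [this]

/-- Poisson summation for an even Schwartz function on the lattice `tℤ`: the trapezoidal rule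
approximates the integral to any polynomial order in `t`. -/
lemma exists_abs_tsum_sub_integral_le (f : 𝓢(ℝ, ℝ)) (hf : ∀ x, f (-x) = f x) {N : ℕ}
    (hN : 1 ≤ N) :
    ∃ C, ∀ t : ℝ, 0 < t →
      |∑' n : ℕ, f (((n + 1 : ℕ) : ℝ) * t) - (t⁻¹ * (∫ x, f x) - f 0) / 2| ≤ C * t ^ N := by
  set fc : 𝓢(ℝ, ℂ) := f.postcompCLM Complex.ofRealCLM with hfc
  have hfc_apply (x : ℝ) : fc x = (f x : ℂ) := rfl
  obtain ⟨C, hC0, hC⟩ := (𝓕 fc).decay (N + 1) 0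
  simp only [norm_iteratedFDeriv_zero, Real.norm_eq_abs] at hC
  have hZ : Summable fun n : ℕ+ => 1 / (n : ℝ) ^ (N + 1) :=
    (summable_one_div_nat_pow.2 (by lia : 1 < N + 1)).comp_injective PNat.coe_injective
  refine ⟨C * ∑' n : ℕ+, 1 / (n : ℝ) ^ (N + 1), fun t ht => ?_⟩
  set ft : 𝓢(ℝ, ℂ) := compCLMOfContinuousLinearEquiv ℂ
    (ContinuousLinearEquiv.unitsEquivAut ℝ (Units.mk0 t ht.ne')) fc with hft
  have hft_apply (x : ℝ) : ft x = (f (x * t) : ℂ) := rfl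
  have hF (w : ℝ) : 𝓕 ft w = (t⁻¹ : ℝ) * 𝓕 fc (w / t) := fourier_comp_mul_right fc ht w
  have hbound (n : ℤ) (m : ℕ+) (hnm : |(n : ℝ)| = m) :
      ‖𝓕 ft n‖ ≤ C * t ^ N * (1 / (m : ℝ) ^ (N + 1)) := by
    have h := hC (n / t)
    have hm : (0 : ℝ) < m := by exact_mod_cast m.pos
    rw [abs_div, hnm, abs_of_pos ht, div_pow, ← le_div_iff₀' (by positivity)] at h
    rw [hF, norm_mul, Complex.norm_real, Real.norm_of_nonneg (inv_pos.2 ht).le]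
    calc t⁻¹ * ‖𝓕 fc (n / t)‖ ≤ t⁻¹ * (C / ((m : ℝ) ^ (N + 1) / t ^ (N + 1))) := by gcongr
      _ = C * t ^ N * (1 / (m : ℝ) ^ (N + 1)) := by
        rw [pow_succ t]
        field_simp
  have hpoisson := SchwartzMap.tsum_eq_tsum_fourier ft 0
  simp only [zero_add, QuotientAddGroup.mk_zero, fourier_eval_zero, mul_one] at hpoisson
  rw [tsum_int_eq_zero_add_two_mul_tsum_pnat (fun n => by simp [hft_apply, hf])
    (summable_schwartz_int ft), tsum_int_eq_zero_add_tsum_pnat (summable_schwartz_int (𝓕 ft))]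
    at hpoisson
  have h1 := tsum_of_norm_bounded ((hZ.mul_left (C * t ^ N)).hasSum)
    (fun n : ℕ+ => hbound (n : ℤ) n (by simp))
  have h2 := tsum_of_norm_bounded ((hZ.mul_left (C * t ^ N)).hasSum)
    (fun n : ℕ+ => hbound (-(n : ℤ)) n (by simp))
  rw [tsum_mul_left] at h1 h2
  have hS : ∑' n : ℕ+, ft ((n : ℤ) : ℝ) = ((∑' n : ℕ, f (((n + 1 : ℕ) : ℝ) * t) : ℝ) : ℂ) := by
    rw [Complex.ofReal_tsum, ← tsum_pnat_eq_tsum_succ (f := fun n : ℕ => ((f (n * t) : ℝ) : ℂ))]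
    rfl
  have h0 : 𝓕 ft ((0 : ℤ) : ℝ) = ((t⁻¹ * ∫ x, f x : ℝ) : ℂ) := by
    rw [hF, fourier_coe, Real.fourier_real_eq_integral_exp_smul]
    simp [hfc_apply, integral_complex_ofReal]
  rw [hS, h0] at hpoisson
  have key : ((∑' n : ℕ, f (((n + 1 : ℕ) : ℝ) * t) - (t⁻¹ * (∫ x, f x) - f 0) / 2 : ℝ) : ℂ) =
      (∑' n : ℕ+, 𝓕 ft ((n : ℤ) : ℝ) + ∑' n : ℕ+, 𝓕 ft ((-(n : ℤ) : ℤ) : ℝ)) / 2 := by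
    have : ft ((0 : ℤ) : ℝ) = (f 0 : ℂ) := by simp [hft_apply]
    rw [this] at hpoisson
    push_cast at hpoisson ⊢
    linear_combination hpoisson / 2
  rw [← Real.norm_eq_abs, ← Complex.norm_real, key, norm_div, Complex.norm_two,
    div_le_iff₀ two_pos]
  refine (norm_add_le _ _).trans ((add_le_add h1 h2).trans (le_of_eq ?_))
  ring

/-- The Schwartz function `x ↦ f (x ^ k)`. -/
noncomputable def compPow {k : ℕ} (hk : 1 ≤ k) (f : 𝓢(ℝ, ℝ)) : 𝓢(ℝ, ℝ) :=
  compCLM ℝ (g := fun x : ℝ => x ^ k) (by fun_prop) ⟨1, 1, fun x => by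
    rw [one_mul, pow_one, norm_pow]
    rcases le_or_gt ‖x‖ 1 with h | h
    · have := pow_nonneg (norm_nonneg x) k
      linarith
    · have := pow_le_pow_right₀ h.le hk
      rw [pow_one] at this
      linarith⟩ f

lemma compPow_apply {k : ℕ} (hk : 1 ≤ k) (f : 𝓢(ℝ, ℝ)) (x : ℝ) : compPow hk f x = f (x ^ k) :=
  rfl

lemma compPow_neg {k : ℕ} (hk : 1 ≤ k) {f : 𝓢(ℝ, ℝ)} (hf : ∀ x, f (-x) = f x) (x : ℝ) :
    compPow hk f (-x) = compPow hk f x := by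
  rw [compPow_apply, compPow_apply]
  rcases k.even_or_odd with h | h
  · rw [h.neg_pow]
  · rw [h.neg_pow, hf]

lemma integral_id_mul_deriv (f : 𝓢(ℝ, ℝ)) :
    Integrable (fun x => x * deriv f x) ∧ ∫ x, x * deriv f x = -∫ x, f x := by
  have h (g : 𝓢(ℝ, ℝ)) : Integrable (fun x => x * g x) := by
    have := (smulLeftCLM ℝ (fun x : ℝ => x) g).integrable (μ := volume)
    refine this.congr (.of_forall fun x => ?_)
    exact smulLeftCLM_apply_apply (by fun_prop) g x
  have h' : Integrable (fun x => x * deriv f x) := h (derivCLM ℝ ℝ f)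
  refine ⟨h', ?_⟩
  have := integral_mul_deriv_eq_deriv_mul_of_integrable (u := fun x : ℝ => x) (v := f)
    (fun x _ => hasDerivAt_id' x) (fun x _ => f.hasDerivAt x) h'
    (f.integrable.congr (.of_forall fun x => by simp)) (h f)
  simpa using this

lemma integral_compPow_boseDeriv_succ {k : ℕ} (hk : 1 ≤ k) (j : ℕ) :
    ∫ x, compPow hk (boseDeriv (j + 1)) x =
      -(((j + 2 : ℕ) : ℝ) + 1 / k) * ∫ x, compPow hk (boseDeriv j) x := by
  have hk0 : (k : ℝ) ≠ 0 := by positivity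
  obtain ⟨hi, hint⟩ := integral_id_mul_deriv (compPow hk (boseDeriv j))
  have hpt (x : ℝ) : compPow hk (boseDeriv (j + 1)) x =
      (k : ℝ)⁻¹ * (x * deriv (compPow hk (boseDeriv j)) x) -
        ((j : ℝ) + 2) * compPow hk (boseDeriv j) x := by
    have hd : deriv (compPow hk (boseDeriv j)) x =
        deriv (boseDeriv j) (x ^ k) * ((k : ℝ) * x ^ (k - 1)) :=
      (((boseDeriv j).hasDerivAt (x ^ k)).comp x (hasDerivAt_pow k x)).deriv
    have hx : x ^ k = x * x ^ (k - 1) := by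
      rw [← pow_succ', Nat.sub_add_cancel hk]
    rw [hd, compPow_apply, compPow_apply, boseDeriv_succ_apply]
    field_simp
    rw [hx]
    ring
  simp_rw [hpt]
  rw [integral_sub (hi.const_mul _) ((compPow hk (boseDeriv j)).integrable.const_mul _),
    integral_const_mul, integral_const_mul, hint]
  push_cast
  ring

lemma hasSum_bose {y : ℝ} (hy : 0 < y) :
    HasSum (fun n : ℕ => (n : ℝ) * exp (-n * y)) (bose y + bose y ^ 2) := by
  have hr : exp (-y) < 1 := by simpa using hy
  have h := hasSum_coe_mul_geometric_of_norm_lt_one (𝕜 := ℝ) (r := exp (-y))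
    (by rwa [Real.norm_of_nonneg (exp_pos _).le])
  have e : exp (-y) / (1 - exp (-y)) ^ 2 = bose y + bose y ^ 2 := by
    have h1 := exp_sub_one_ne_zero hy.ne'
    have h2 : 1 - exp (-y) = (exp y - 1) / exp y := by
      rw [exp_neg]; field_simp
    rw [h2, exp_neg, bose]
    field_simp
    ring
  rw [e] at h
  refine h.congr_fun fun n => ?_
  rw [← exp_nat_mul]
  ring_nf

lemma mellin_boseKernel {r : ℝ} (hr : 0 < r) :
    mellin (fun y => (boseKernel y : ℂ)) r =
      Complex.Gamma (r + 2) * riemannZeta (r + 1) := by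
  have hs := hasSum_mellin (a := fun n : ℕ => (n : ℂ)) (p := fun n : ℕ => (n : ℝ))
    (F := fun y => ((bose y + bose y ^ 2 : ℝ) : ℂ)) (s := (r : ℂ) + 2)
    (fun n => by rcases n.eq_zero_or_pos with h | h <;> simp [h])
    (by simp; linarith)
    (fun t ht => by
      have := Complex.hasSum_ofReal.2 (hasSum_bose ht)
      simpa using this)
    (by
      have h2 : ((r : ℂ) + 2).re = (r + 1) + 1 := by simp; ring
      have := Real.summable_one_div_nat_rpow.2 (by linarith : 1 < r + 1)
      refine this.congr fun n => ?_
      rcases n.eq_zero_or_pos with h | h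
      · subst h
        simp [h2, Real.zero_rpow (by linarith : r + 1 ≠ 0)]
      · have hn : (0 : ℝ) < n := by exact_mod_cast h
        rw [h2, Real.rpow_add_one hn.ne' (r + 1), Complex.norm_natCast, mul_comm,
          ← div_div, div_self hn.ne'])
  have h1 : mellin (fun y => (boseKernel y : ℂ)) r =
      mellin (fun y => ((bose y + bose y ^ 2 : ℝ) : ℂ)) (r + 2) := by
    rw [← mellin_cpow_smul]
    refine setIntegral_congr_fun measurableSet_Ioi fun t ht => ?_
    simp only [boseKernel_eq (ne_of_gt ht)]
    simp
  rw [h1, ← hs.tsum_eq, zeta_eq_tsum_one_div_nat_cpow (by simpa using hr), ← tsum_mul_left]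
  refine tsum_congr fun n => ?_
  rcases n.eq_zero_or_pos with h | h
  · subst h
    have : (r : ℂ) + 1 ≠ 0 := by exact_mod_cast (by linarith : r + 1 ≠ 0)
    simp [this]
  · have hn : (n : ℂ) ≠ 0 := by exact_mod_cast h.ne'
    have : (r : ℂ) + 2 = (r + 1) + 1 := by ring
    rw [Complex.ofReal_natCast, this, Complex.cpow_add _ 1 hn, Complex.cpow_one,
      mul_div_mul_right _ _ hn, mul_one_div]

lemma integral_compPow_boseSchwartz {k : ℕ} (hk : 1 ≤ k) :
    ∫ x, compPow hk boseSchwartz x =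
      2 * ((1 + 1 / (k : ℝ)) * ((k : ℝ)⁻¹ * (riemannZeta (1 + 1 / (k : ℂ))).re *
        Real.Gamma (1 + 1 / (k : ℝ)))) := by
  have hk0 : (0 : ℝ) < k := by exact_mod_cast hk
  have habs : ∫ x, compPow hk boseSchwartz x = ∫ x, compPow hk boseSchwartz |x| := by
    refine integral_congr_ae (.of_forall fun x => ?_)
    rcases abs_choice x with h | h <;> simp only [h]
    exact (compPow_neg hk boseKernel_neg x).symm
  rw [habs, integral_comp_abs]
  congr 1
  have hm : ((∫ x in Ioi (0 : ℝ), compPow hk boseSchwartz x : ℝ) : ℂ) =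
      mellin (fun x : ℝ => (boseKernel (x ^ (k : ℝ)) : ℂ)) 1 := by
    rw [← integral_complex_ofReal]
    refine setIntegral_congr_fun measurableSet_Ioi fun t ht => ?_
    simp only [rpow_natCast, sub_self, Complex.cpow_zero, one_smul]
    rfl
  have hG : Real.Gamma (1 / (k : ℝ) + 2) = (1 + 1 / (k : ℝ)) * Real.Gamma (1 + 1 / (k : ℝ)) := by
    rw [← Real.Gamma_add_one (by positivity)]
    ring_nf
  have h1 : (1 : ℂ) / ((k : ℝ) : ℂ) = ((1 / (k : ℝ) : ℝ) : ℂ) := by push_cast; rfl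
  rw [mellin_comp_rpow (fun y => (boseKernel y : ℂ)) 1 k, h1, mellin_boseKernel (by positivity)]
    at hm
  have h2 : (((1 / (k : ℝ) : ℝ) : ℂ) + 2) = ((1 / (k : ℝ) + 2 : ℝ) : ℂ) := by push_cast; rfl
  rw [h2, Complex.Gamma_ofReal, hG, abs_of_pos hk0] at hm
  have h3 := congrArg Complex.re hm
  rw [Complex.ofReal_re, Complex.real_smul, Complex.re_ofReal_mul, Complex.re_ofReal_mul] at h3
  rw [h3]
  have h4 : (((1 / (k : ℝ) : ℝ) : ℂ) + 1) = 1 + 1 / (k : ℂ) := by push_cast; ring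
  rw [h4]
  ring

lemma riemannZeta_re_nonneg {x : ℝ} (hx : 1 < x) : 0 ≤ (riemannZeta x).re := by
  rw [zeta_eq_tsum_one_div_nat_cpow (by simpa using hx)]
  have : ∑' n : ℕ, 1 / (n : ℂ) ^ (x : ℂ) = ((∑' n : ℕ, 1 / (n : ℝ) ^ x : ℝ) : ℂ) := by
    rw [Complex.ofReal_tsum]
    refine tsum_congr fun n => ?_
    rw [Complex.ofReal_div, Complex.ofReal_cpow n.cast_nonneg]
    simp
  rw [this, Complex.ofReal_re]
  exact tsum_nonneg fun n => by positivity

lemma ak_rpow {k : ℕ} (hk : 1 ≤ k) :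
    ak k ^ (1 + 1 / (k : ℝ)) =
      (k : ℝ)⁻¹ * (riemannZeta (1 + 1 / (k : ℂ))).re * Real.Gamma (1 + 1 / (k : ℝ)) := by
  have hk0 : (0 : ℝ) < k := by exact_mod_cast hk
  have hz : 0 ≤ (riemannZeta (1 + 1 / (k : ℂ))).re := by
    have := riemannZeta_re_nonneg (x := 1 + 1 / (k : ℝ)) (by
      have : 0 < 1 / (k : ℝ) := by positivity
      linarith)
    push_cast at this
    exact this
  have hG : 0 < Real.Gamma (1 + 1 / (k : ℝ)) := Real.Gamma_pos_of_pos (by positivity)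
  rw [ak, ← rpow_mul (by positivity)]
  have : (k : ℝ) / (k + 1) * (1 + 1 / k) = 1 := by field_simp
  rw [this, rpow_one]

lemma integral_compPow_boseDeriv {k : ℕ} (hk : 1 ≤ k) (j : ℕ) :
    ∫ x, compPow hk (boseDeriv j) x =
      2 * ((-1) ^ j * (ak k ^ (1 + 1 / (k : ℝ)) *
        ∏ ℓ ∈ Finset.Ico 1 (j + 2), ((ℓ : ℝ) + 1 / k))) := by
  induction j with
  | zero =>
    rw [ak_rpow hk, boseDeriv, integral_compPow_boseSchwartz]
    simp
    ring
  | succ j ih =>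
    rw [integral_compPow_boseDeriv_succ, ih, Finset.prod_Ico_succ_top (by lia : 1 ≤ j + 2)]
    ring

lemma exists_abs_iteratedDeriv_Phi_sub_le {k : ℕ} (hk : 1 ≤ k) (j J : ℕ) :
    ∃ C, ∀ s : ℝ, 0 < s →
      |(-1 : ℝ) ^ (j + 2) * iteratedDeriv (j + 2) (Phi k) s -
          ((ak k ^ (1 + 1 / (k : ℝ)) / s ^ (((j + 2 : ℕ) : ℝ) + 1 / k)) *
              ∏ ℓ ∈ Finset.Ico 1 (j + 2), ((ℓ : ℝ) + 1 / k)
            - (Nat.factorial (j + 1) : ℝ) / (2 * s ^ (j + 2)))| ≤ C * s ^ J := by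
  obtain ⟨C, hC⟩ := exists_abs_tsum_sub_integral_le (compPow hk (boseDeriv j))
    (compPow_neg hk (boseDeriv_neg j)) (N := k * (J + (j + 2))) (Nat.mul_pos hk (by lia))
  refine ⟨C, fun s hs => ?_⟩
  have hk0 : (k : ℝ) ≠ 0 := by exact_mod_cast (by lia : k ≠ 0)
  set t : ℝ := s ^ (1 / (k : ℝ)) with ht
  have ht0 : 0 < t := Real.rpow_pos_of_pos hs _
  have htk : t ^ k = s := by
    rw [ht, ← Real.rpow_natCast, ← Real.rpow_mul hs.le, one_div_mul_cancel hk0, Real.rpow_one]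
  have hPhi : iteratedDeriv (j + 2) (Phi k) s =
      (∑' n : ℕ, compPow hk (boseDeriv j) (((n + 1 : ℕ) : ℝ) * t)) / s ^ (j + 2) := by
    rw [iteratedDeriv_Phi hk _ hs, ← tsum_div_const]
    refine tsum_congr fun n => ?_
    have hn : (((n + 1 : ℕ) : ℝ) ^ k) ^ (j + 2) ≠ 0 := by positivity
    rw [logDer_add_two, compPow_apply, mul_pow _ t, htk, mul_pow _ s, mul_div_assoc',
      mul_div_mul_left _ _ hn]
  have h0 : compPow hk (boseDeriv j) 0 = (-1) ^ j * (Nat.factorial (j + 1) : ℝ) := by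
    rw [compPow_apply, zero_pow (by lia), boseDeriv_apply_zero]
  have hpow : s ^ (((j + 2 : ℕ) : ℝ) + 1 / k) = s ^ (j + 2) * t := by
    rw [Real.rpow_add hs, Real.rpow_natCast]
  have hmain := hC t ht0
  rw [integral_compPow_boseDeriv, h0, pow_mul, htk] at hmain
  rw [hPhi, hpow]
  set S := ∑' n : ℕ, compPow hk (boseDeriv j) (((n + 1 : ℕ) : ℝ) * t)
  set P := ∏ ℓ ∈ Finset.Ico 1 (j + 2), ((ℓ : ℝ) + 1 / k)
  set A := ak k ^ (1 + 1 / (k : ℝ))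
  have hsq : ((-1 : ℝ) ^ j) * (-1) ^ j = 1 := by rw [← mul_pow]; simp
  have key : (-1 : ℝ) ^ (j + 2) * (S / s ^ (j + 2)) - (A / (s ^ (j + 2) * t) * P -
      (Nat.factorial (j + 1) : ℝ) / (2 * s ^ (j + 2))) =
      (-1) ^ j * (S - (t⁻¹ * (2 * ((-1) ^ j * (A * P))) -
        (-1) ^ j * (Nat.factorial (j + 1) : ℝ)) / 2) / s ^ (j + 2) := by
    have hs' : s ^ (j + 2) ≠ 0 := by positivity
    have hpar : (-1 : ℝ) ^ (j + 2) = (-1) ^ j := by ring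
    rw [hpar]
    generalize s ^ (j + 2) = u at *
    generalize (-1 : ℝ) ^ j = e at *
    field_simp
    linear_combination (2 * A * P - t * (Nat.factorial (j + 1) : ℝ)) * hsq
  rw [key, abs_div, abs_mul, abs_pow, abs_neg, abs_one, one_pow, one_mul,
    abs_of_pos (pow_pos hs _), div_le_iff₀ (pow_pos hs _), mul_assoc, ← pow_add]
  exact hmain

end

theorem Phi_derivatives_asymptotic (k m J : ℕ) (hk : 1 ≤ k) (hm : 2 ≤ m) (hJ : 1 ≤ J)
    (σ : ℕ → ℝ)
    (hσ : ∀ n : ℕ, 1 ≤ n → 0 < σ n ∧ -deriv (Phi k) (σ n) = n) :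
    ∃ C : ℝ, 0 < C ∧ ∃ N : ℕ, ∀ n : ℕ, N ≤ n →
      |(-1 : ℝ) ^ m * iteratedDeriv m (Phi k) (σ n) -
          ((ak k ^ (1 + 1 / (k : ℝ)) / (σ n) ^ ((m : ℝ) + 1 / k)) *
              ∏ ℓ ∈ Finset.Ico 1 m, ((ℓ : ℝ) + 1 / k)
            - (Nat.factorial (m - 1) : ℝ) / (2 * (σ n) ^ m))| ≤ C * (σ n) ^ J := by
  obtain ⟨j, rfl⟩ := Nat.exists_eq_add_of_le' hm
  obtain ⟨C, hC⟩ := exists_abs_iteratedDeriv_Phi_sub_le hk j J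
  refine ⟨max C 1, lt_max_of_lt_right one_pos, 1, fun n hn => ?_⟩
  have hs := (hσ n hn).1
  exact (hC _ hs).trans (mul_le_mul_of_nonneg_right (le_max_left _ _) (pow_nonneg hs.le _))
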